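/- Let G be a finite simple graph of order n and let k = n−2, with k ≥ 2. If the average degree 2·e(G)/n of G is strictly greater than k−2, then G contains every tree of order k as a subgraph. -/

import Mathlib

open SimpleGraph

namespace SimpleGraph

section TreeStructure

variable {W : Type*} {T : SimpleGraph W}

/-- In a rooted tree, a vertex has at most one neighbor that is no deeper than itself. -/
theorem IsTree.parent_unique (hT : T.IsTree) (r : W) {a b w : W} (ha : T.Adj w a) (hb : T.Adj w b)
    (hda : T.dist r a ≤ T.dist r w) (hdb : T.dist r b ≤ T.dist r w) : a = b := by
  obtain ⟨q, hq, hql⟩ := hT.connected.exists_path_of_dist r w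
  have key : ∀ c, T.Adj w c → T.dist r c ≤ T.dist r w → c = q.penultimate := by
    intro c hc hdc
    obtain ⟨p, hp, hpl⟩ := hT.connected.exists_path_of_dist r c
    refine hT.isAcyclic.eq_penultimate_of_adj_end hq hc ?_
    by_contra hcq
    have hw := hT.isAcyclic.mem_support_of_ne_mem_support_of_adj_of_isPath hp hq hc.symm hcq
    have h := congrArg Walk.length (hT.isAcyclic.path_concat hq hp hc hw)
    rw [Walk.length_concat] at h
    omega
  rw [key a ha hda, key b hb hdb]

theorem Connected.exists_adj_dist_succ (hT : T.Connected) {r w : W} (h : w ≠ r) :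
    ∃ a, T.Adj w a ∧ T.dist r a + 1 = T.dist r w := by
  obtain ⟨p, hp⟩ := hT.exists_walk_length_eq_dist w r
  cases p with
  | nil => exact absurd rfl h
  | @cons _ a _ hadj p' =>
    refine ⟨a, hadj, ?_⟩
    have h1 := dist_le p'
    have h2 : T.dist w r ≤ T.dist a r + 1 := by
      obtain ⟨p'', hp''⟩ := hT.exists_walk_length_eq_dist a r
      rw [← hp'']
      exact dist_le (p''.cons hadj)
    simp only [Walk.length_cons] at hp
    rw [dist_comm (u := r), dist_comm (u := r)]
    omega

/-- All neighbors of `p` except `q` are leaves, and there is at least one such leaf. -/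
def IsPendantStar (T : SimpleGraph W) (p q : W) : Prop :=
  T.Adj p q ∧ (∃ l, T.Adj p l ∧ l ≠ q) ∧ ∀ l, T.Adj p l → l ≠ q → ∀ w, T.Adj l w → w = p

theorem IsTree.isPendantStar_of_deepest (hT : T.IsTree) {r u p q : W}
    (hu : ∀ w, T.dist r w ≤ T.dist r u) (hup : T.Adj u p) (hp : T.dist r p + 1 = T.dist r u)
    (hpq : T.Adj p q) (hq : T.dist r q + 1 = T.dist r p) : IsPendantStar T p q := by
  refine ⟨hpq, ⟨u, hup.symm, fun h => ?_⟩, fun l hl hlq w hw => ?_⟩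
  · rw [h] at hp
    omega
  · have h1 : T.dist r p < T.dist r l := by
      by_contra hlt
      exact hlq (hT.parent_unique r hl hpq (by omega) (by omega))
    have h2 := hu l
    have h3 := hu w
    exact hT.parent_unique r hw hl.symm (by omega) (by omega)

/-- A tree with an edge either has a dominating edge or two pendant stars
with nonadjacent centers. -/
theorem IsTree.exists_dominating_edge_or_pendantStars [Finite W] [Nontrivial W] (hT : T.IsTree) :
    (∃ p q, T.Adj p q ∧ ∀ w, T.Adj p w ∨ T.Adj q w) ∨
    ∃ p q p' q', IsPendantStar T p q ∧ IsPendantStar T p' q' ∧ p ≠ p' ∧ ¬ T.Adj p p' := by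
  obtain ⟨r⟩ := hT.connected.nonempty
  obtain ⟨u, hu⟩ := Finite.exists_max (T.dist r)
  have hur : u ≠ r := by
    rintro rfl
    obtain ⟨x, hx⟩ := exists_ne u
    have := hu x
    have := hT.connected.pos_dist_of_ne hx.symm
    rw [dist_self] at *
    omega
  obtain ⟨p, hup, hp⟩ := hT.connected.exists_adj_dist_succ hur
  by_cases hpr : p = r
  · subst hpr
    left
    refine ⟨p, u, hup.symm, fun w => ?_⟩
    by_cases hw : w = p
    · exact Or.inr (hw ▸ hup)
    · left
      have h1 := hu w
      have h2 := hT.connected.pos_dist_of_ne (Ne.symm hw)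
      rw [dist_self] at hp
      exact dist_eq_one_iff_adj.1 (by omega)
  obtain ⟨q, hpq, hq⟩ := hT.connected.exists_adj_dist_succ hpr
  have hend := hT.isPendantStar_of_deepest hu hup hp hpq hq
  have huq : u ≠ q := by
    rintro rfl
    omega
  have hleaf : ∀ w, T.Adj u w → w = p := hend.2.2 u hup.symm huq
  have dist_one : ∀ z, T.dist u z = 1 → z = p := fun z hz =>
    hleaf z (dist_eq_one_iff_adj.1 hz)
  obtain ⟨v, hv⟩ := Finite.exists_max (T.dist u)
  by_cases hd : T.dist u v ≤ 3
  · left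
    refine ⟨p, q, hpq, fun z => ?_⟩
    have dist_two : ∀ z, T.dist u z = 2 → T.Adj p z := by
      intro z hz
      obtain ⟨a, ha, hda⟩ := hT.connected.exists_adj_dist_succ
        (show z ≠ u by rintro rfl; simp at hz)
      exact dist_one a (by omega) ▸ ha.symm
    have h3 := (hv z).trans hd
    interval_cases h : T.dist u z
    · rw [hT.connected.dist_eq_zero_iff] at h
      exact Or.inl (h ▸ hup.symm)
    · exact Or.inr (dist_one z h ▸ hpq.symm)
    · exact Or.inl (dist_two z h)
    · obtain ⟨a, ha, hda⟩ := hT.connected.exists_adj_dist_succ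
        (show z ≠ u by rintro rfl; simp at h)
      right
      by_cases haq : a = q
      · exact haq ▸ ha.symm
      · have := hend.2.2 a (dist_two a (by omega)) haq z ha.symm
        rw [this, dist_eq_one_iff_adj.2 hup] at h
        omega
  · right
    have ne_u : ∀ z, 0 < T.dist u z → z ≠ u := by
      rintro z hz rfl
      simp at hz
    obtain ⟨p', hvp', hp'⟩ :=
      hT.connected.exists_adj_dist_succ (ne_u v (by omega))
    obtain ⟨q', hpq', hq'⟩ :=
      hT.connected.exists_adj_dist_succ (ne_u p' (by omega))
    have hup1 := dist_eq_one_iff_adj.2 hup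
    refine ⟨p, q, p', q', hend, hT.isPendantStar_of_deepest hv hvp' hp' hpq' hq', ?_, fun h => ?_⟩
    · rintro rfl
      omega
    · have := h.diff_dist_adj (u := u)
      omega

/-- Vertex partition of a double star with adjacent centers `p`, `q` and leaf classes `A`, `B`. -/
def IsDoubleStar (T : SimpleGraph W) (p q : W) (A B : Finset W) : Prop :=
  p ≠ q ∧ p ∉ A ∧ q ∉ A ∧ p ∉ B ∧ q ∉ B ∧ Disjoint A B ∧ (∀ w, w = p ∨ w = q ∨ w ∈ A ∨ w ∈ B) ∧
    ∀ x y, T.Adj x y → (x = p ∧ (y = q ∨ y ∈ A)) ∨ (x = q ∧ (y = p ∨ y ∈ B)) ∨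
      (y = p ∧ (x = q ∨ x ∈ A)) ∨ (y = q ∧ (x = p ∨ x ∈ B))

theorem IsDoubleStar.symm {p q : W} {A B : Finset W}
    (h : IsDoubleStar T p q A B) : IsDoubleStar T q p B A := by
  obtain ⟨h1, h2, h3, h4, h5, h6, h7, h8⟩ := h
  refine ⟨h1.symm, h5, h4, h3, h2, h6.symm, fun w => ?_, fun x y hxy => ?_⟩
  · have := h7 w
    tauto
  · have := h8 x y hxy
    tauto

theorem IsTree.exists_isDoubleStar [Fintype W] (hT : T.IsTree) {p q : W}
    (hpq : T.Adj p q) (hdom : ∀ w, T.Adj p w ∨ T.Adj q w) :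
    ∃ A B, IsDoubleStar T p q A B := by
  classical
  refine ⟨Finset.univ.filter fun w => T.Adj p w ∧ w ≠ q,
    Finset.univ.filter fun w => ¬ T.Adj p w ∧ w ≠ p, hpq.ne, by simp, by simp, by simp,
    by simp [hpq], ?_, fun w => ?_, ?_⟩
  · rw [Finset.disjoint_left]
    simp
    tauto
  · simp
    tauto
  have hq : T.dist p q = 1 := dist_eq_one_iff_adj.2 hpq
  have key : ∀ x y, T.Adj x y → T.dist p x ≤ T.dist p y →
      (x = p ∧ (y = q ∨ (T.Adj p y ∧ y ≠ q))) ∨ (x = q ∧ (¬ T.Adj p y ∧ y ≠ p)) := by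
    intro x y hxy hd
    by_cases hyp : y = p
    · rw [hyp, dist_self, Nat.le_zero, hT.connected.dist_eq_zero_iff] at hd
      exact absurd (hd ▸ hyp ▸ rfl) hxy.ne
    by_cases hpy : T.Adj p y
    · have : x = p := hT.parent_unique p hxy.symm hpy.symm hd (by simp)
      tauto
    · have hqy := (hdom y).resolve_left hpy
      have h2 := hT.connected.one_lt_dist_of_ne_of_not_adj (Ne.symm hyp) hpy
      have : x = q := hT.parent_unique p hxy.symm hqy.symm hd (by omega)
      tauto
  intro x y hxy
  simp only [Finset.mem_filter, Finset.mem_univ, true_and]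
  rcases le_total (T.dist p x) (T.dist p y) with h | h
  · have := key x y hxy h
    tauto
  · have := key y x hxy.symm h
    tauto

/-- Connectivity is inherited by the complement of a set that can be folded away. -/
theorem Connected.induce_of_retraction {s : Set W} (hT : T.Connected) (r : W → W)
    (hr : ∀ w, r w ∈ s) (hfix : ∀ w ∈ s, r w = w)
    (hadj : ∀ u v, T.Adj u v → r u = r v ∨ T.Adj (r u) (r v)) : (T.induce s).Connected := by
  have key : ∀ u v : W, T.Walk u v →
      (T.induce s).Reachable ⟨r u, hr u⟩ ⟨r v, hr v⟩ := by
    intro u v p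
    induction p with
    | nil => exact Reachable.refl _
    | @cons a b c hab _ ih =>
      refine Reachable.trans ?_ ih
      rcases hadj a b hab with h | h
      · simp only [h]
        exact Reachable.refl _
      · exact Adj.reachable (by simpa using h)
  obtain ⟨w⟩ := hT.nonempty
  rw [connected_iff]
  refine ⟨fun u v => ?_, ⟨r w, hr w⟩⟩
  obtain ⟨p⟩ := hT.preconnected u v
  have := key u v p
  simpa only [hfix _ u.2, hfix _ v.2] using this

end TreeStructure

section DegreeSums

open scoped Classical

variable {V : Type*} [Fintype V] (H : SimpleGraph V)

/-- The number of neighbors of `v` outside `R`. -/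
noncomputable def degreeAvoiding (R : Finset V) (v : V) : ℕ :=
  (Finset.univ.filter fun w => w ∉ R ∧ H.Adj v w).card

/-- The degree sum of the graph obtained by deleting `R`. -/
noncomputable def degreeSumAvoiding (R : Finset V) : ℕ :=
  ∑ v ∈ Rᶜ, H.degreeAvoiding R v

variable {H}

theorem degreeAvoiding_empty (v : V) : H.degreeAvoiding ∅ v = H.degree v := by
  simp [degreeAvoiding, ← card_neighborFinset_eq_degree, neighborFinset_eq_filter]

theorem degreeSumAvoiding_empty : H.degreeSumAvoiding ∅ = ∑ v, H.degree v := by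
  simp [degreeSumAvoiding, degreeAvoiding_empty]

theorem degreeAvoiding_insert {R : Finset V} {x : V} (hx : x ∉ R) (v : V) :
    H.degreeAvoiding R v = H.degreeAvoiding (insert x R) v + if H.Adj v x then 1 else 0 := by
  unfold degreeAvoiding
  split_ifs with h
  · rw [← Finset.card_insert_of_notMem (a := x) (by simp)]
    congr 1
    ext w
    by_cases hw : w = x <;> simp [hw, hx, h]
  · congr 1
    ext w
    by_cases hw : w = x <;> simp [hw, h]

theorem degreeSumAvoiding_insert {R : Finset V} {x : V} (hx : x ∉ R) :
    H.degreeSumAvoiding R = H.degreeSumAvoiding (insert x R) + 2 * H.degreeAvoiding R x := by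
  have hmem : x ∈ Rᶜ := by simpa using hx
  have hsum : ∑ v ∈ Rᶜ.erase x, (if H.Adj v x then 1 else 0) = H.degreeAvoiding R x := by
    rw [← Finset.card_filter]
    unfold degreeAvoiding
    congr 1
    ext w
    by_cases hw : w = x <;> simp [hw, H.adj_comm]
  unfold degreeSumAvoiding
  rw [← Finset.add_sum_erase _ _ hmem, Finset.compl_insert,
    Finset.sum_congr rfl fun v _ => degreeAvoiding_insert hx v, Finset.sum_add_distrib, hsum]
  omega

/-- Deleting a vertex of maximum degree repairs a small excess of the degree sum. -/
theorem exists_degreeSumAvoiding_insert_lt {R : Finset V} (hR : R.card + 2 ≤ Fintype.card V)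
    (h : H.degreeSumAvoiding R ≤ 3 * (Fintype.card V - R.card) + 4) :
    ∃ x ∉ R, H.degreeSumAvoiding (insert x R) < 3 * (Fintype.card V - (insert x R).card) := by
  have hc : Rᶜ.card = Fintype.card V - R.card := Finset.card_compl R
  have hne : Rᶜ.Nonempty := Finset.card_pos.1 (by omega)
  obtain ⟨x, hx, hmax⟩ := Finset.exists_max_image Rᶜ (H.degreeAvoiding R) hne
  have hxR : x ∉ R := by simpa using hx
  refine ⟨x, hxR, ?_⟩
  have hle : H.degreeSumAvoiding R ≤ Rᶜ.card * H.degreeAvoiding R x :=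
    Finset.sum_le_card_nsmul _ _ _ hmax
  have hins := degreeSumAvoiding_insert (H := H) hxR
  rw [Finset.card_insert_of_notMem hxR]
  rw [hc] at hle
  by_cases h4 : 4 ≤ H.degreeAvoiding R x
  · omega
  · generalize H.degreeAvoiding R x = d at *
    interval_cases d <;> omega

theorem exists_superset_degreeSumAvoiding_lt (j : ℕ) {R : Finset V}
    (hR : R.card + j + 2 ≤ Fintype.card V)
    (h : H.degreeSumAvoiding R ≤ 3 * (Fintype.card V - R.card) + 4) :
    ∃ Z, R ⊆ Z ∧ Z.card = R.card + (j + 1) ∧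
      H.degreeSumAvoiding Z < 3 * (Fintype.card V - Z.card) := by
  induction j generalizing R with
  | zero =>
    obtain ⟨x, hx, hlt⟩ := exists_degreeSumAvoiding_insert_lt (by omega) h
    exact ⟨_, Finset.subset_insert x R, Finset.card_insert_of_notMem hx, hlt⟩
  | succ j ih =>
    obtain ⟨x, hx, hlt⟩ := exists_degreeSumAvoiding_insert_lt (by omega) h
    have hcard := Finset.card_insert_of_notMem hx
    obtain ⟨Z, hZ, hZc, hZlt⟩ := ih (R := insert x R) (by omega) (by omega)
    exact ⟨Z, (Finset.subset_insert x R).trans hZ, by omega, hZlt⟩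

theorem degreeSumAvoiding_induce (R : Finset V) :
    (H.induce {v | v ∉ R}).degreeSumAvoiding ∅ = H.degreeSumAvoiding R := by
  have hdeg : ∀ v : {v | v ∉ R},
      (H.induce {v | v ∉ R}).degreeAvoiding ∅ v = H.degreeAvoiding R v := by
    intro v
    unfold degreeAvoiding
    rw [← Finset.card_map (Function.Embedding.subtype _)]
    congr 1
    ext w
    simp [and_comm]
  unfold degreeSumAvoiding
  rw [Finset.sum_congr rfl fun v _ => hdeg v]
  have h := Finset.sum_subtype (p := fun v => v ∈ {v | v ∉ R}) (F := inferInstance) Rᶜ (by simp)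
    (H.degreeAvoiding R)
  rw [h]
  exact Finset.sum_congr (by ext; simp) fun _ _ => rfl

end DegreeSums

section Packing

open scoped Classical

variable {V W : Type*} {H : SimpleGraph V} {T : SimpleGraph W}

/-- `T` embeds into the complement of `H`. -/
def Packs (T : SimpleGraph W) (H : SimpleGraph V) : Prop :=
  ∃ f : W → V, Function.Injective f ∧ ∀ u v, T.Adj u v → ¬ H.Adj (f u) (f v)

/-- `g` embeds `T - S` into the complement of `H - R`. -/
def IsPartialPacking (T : SimpleGraph W) (H : SimpleGraph V) (S : Finset W) (R : Finset V)
    (g : W → V) : Prop :=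
  (∀ u ∉ S, ∀ v ∉ S, g u = g v → u = v) ∧ (∀ w ∉ S, g w ∉ R) ∧
    ∀ u ∉ S, ∀ v ∉ S, T.Adj u v → ¬ H.Adj (g u) (g v)

/-- Whenever `T - S` is a retract of `T` and `H - R` has average degree below three,
`T - S` packs with `H - R`, leaving two vertices of `H - R` unused. -/
def DeletionProperty [Fintype V] (T : SimpleGraph W) (H : SimpleGraph V) : Prop :=
  ∀ (S : Finset W) (R : Finset V), S.Nonempty → S.card = R.card →
    (∃ r : W → W, (∀ w, r w ∉ S) ∧ (∀ w ∉ S, r w = w) ∧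
      ∀ u v, T.Adj u v → r u = r v ∨ T.Adj (r u) (r v)) →
    H.degreeSumAvoiding R < 3 * (Fintype.card V - R.card) →
    ∃ g a b, IsPartialPacking T H S R g ∧ a ≠ b ∧ a ∉ R ∧ b ∉ R ∧ ∀ w ∉ S, g w ≠ a ∧ g w ≠ b

/-- `l`, `p`, `q` is a path in `T` in which `l` is a leaf and `p` has degree two. -/
def IsPendantPath (T : SimpleGraph W) (l p q : W) : Prop :=
  T.Adj p q ∧ T.Adj p l ∧ l ≠ q ∧ (∀ w, T.Adj l w → w = p) ∧ ∀ w, T.Adj p w → w = l ∨ w = q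

theorem packs_of_leaf {l p : W} (hpl : T.Adj p l) (hl : ∀ w, T.Adj l w → w = p) {g : W → V}
    (hinj : ∀ u, u ≠ l → ∀ v, v ≠ l → g u = g v → u = v)
    (hadj : ∀ u, u ≠ l → ∀ v, v ≠ l → T.Adj u v → ¬ H.Adj (g u) (g v)) {Y X : V} (hYX : Y ≠ X)
    (hfree : ∀ w, w ≠ l → w ≠ p → g w ≠ Y ∧ g w ≠ X) (hnYX : ¬ H.Adj Y X)
    (hY : ∀ w, w ≠ l → T.Adj p w → ¬ H.Adj Y (g w)) : Packs T H := by
  have hne := hpl.ne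
  refine ⟨fun w => if w = l then X else if w = p then Y else g w, fun u v huv => ?_,
    fun u v huv => ?_⟩
  · grind
  · have := huv.symm
    have := huv.ne
    have h1 : ¬ H.Adj X Y := fun h => hnYX h.symm
    have h2 : ∀ w, w ≠ l → T.Adj p w → ¬ H.Adj (g w) Y := fun w h h' h'' => hY w h h' h''.symm
    grind

theorem packs_of_pendantPath {l p q : W} (hp : IsPendantPath T l p q) {g : W → V}
    (hinj : ∀ u ∉ ({l, p} : Finset W), ∀ v ∉ ({l, p} : Finset W), g u = g v → u = v)
    (hadj : ∀ u ∉ ({l, p} : Finset W), ∀ v ∉ ({l, p} : Finset W),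
      T.Adj u v → ¬ H.Adj (g u) (g v)) {Y X : V}
    (hYX : Y ≠ X) (hfree : ∀ w ∉ ({l, p} : Finset W), g w ≠ Y ∧ g w ≠ X) (hnYX : ¬ H.Adj Y X)
    (hY : ¬ H.Adj Y (g q)) : Packs T H := by
  obtain ⟨hpq, hpl, hlq, hl, hpn⟩ := hp
  refine packs_of_leaf hpl hl (g := fun w => if w = p then Y else g w) ?_ ?_ hYX ?_ hnYX ?_
  · grind
  · intro u hu v hv huv
    have := huv.symm
    have := huv.ne
    have h1 : ¬ H.Adj (g q) Y := fun h => hY h.symm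
    grind
  · grind
  · have := hpq.ne
    intro w hw hpw
    grind

theorem IsPendantPath.ne_of_not_adj {l p q l' p' q' : W} (hp : IsPendantPath T l p q)
    (hp' : IsPendantPath T l' p' q') (hne : p ≠ p') (hnadj : ¬ T.Adj p p') :
    l ≠ l' ∧ p ≠ l' ∧ l ≠ p' ∧ q ≠ p' ∧ q' ≠ p ∧ q ≠ l' ∧ q' ≠ l := by
  obtain ⟨hpq, hpl, -, hl, -⟩ := hp
  obtain ⟨hpq', hpl', -, hl', -⟩ := hp'
  refine ⟨?_, ?_, ?_, ?_, ?_, ?_, ?_⟩ <;> rintro rfl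
  · exact hne (hl' p hpl.symm)
  · exact hnadj (hl' _ hpq ▸ hpq)
  · exact hnadj hpl
  · exact hnadj hpq
  · exact hnadj hpq'.symm
  · exact hne (hl' p hpq.symm)
  · exact hne.symm (hl p' hpq'.symm)

theorem packs_of_pendantPaths {l p q l' p' q' : W} (hp : IsPendantPath T l p q)
    (hp' : IsPendantPath T l' p' q') (hne : p ≠ p') (hnadj : ¬ T.Adj p p') {g : W → V}
    (hinj : ∀ u ∉ ({l, p, l', p'} : Finset W), ∀ v ∉ ({l, p, l', p'} : Finset W),
      g u = g v → u = v)
    (hadj : ∀ u ∉ ({l, p, l', p'} : Finset W), ∀ v ∉ ({l, p, l', p'} : Finset W),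
      T.Adj u v → ¬ H.Adj (g u) (g v)) {Y X Y' X' : V} (hdis : [Y, X, Y', X'].Nodup)
    (hfree : ∀ w ∉ ({l, p, l', p'} : Finset W), g w ∉ [Y, X, Y', X'])
    (hnYX : ¬ H.Adj Y X) (hY : ¬ H.Adj Y (g q)) (hnYX' : ¬ H.Adj Y' X')
    (hY' : ¬ H.Adj Y' (g q')) : Packs T H := by
  obtain ⟨hll, hpl', hlp', hqp', hqp, hql', hql⟩ := hp.ne_of_not_adj hp' hne hnadj
  obtain ⟨hpq1, hpl1, hlq1, hl1, hpn1⟩ := hp'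
  simp only [List.nodup_cons, List.mem_cons, List.not_mem_nil, or_false, not_or, not_false_eq_true,
    List.nodup_nil, and_true, Finset.mem_insert, Finset.mem_singleton] at hdis hfree hinj hadj
  refine packs_of_pendantPath hp
    (g := fun w => if w = l' then X' else if w = p' then Y' else g w) (Y := Y) (X := X) ?_ ?_
    hdis.1.1 ?_ hnYX ?_
  · simp only [Finset.mem_insert, Finset.mem_singleton, not_or]
    grind
  · simp only [Finset.mem_insert, Finset.mem_singleton, not_or]
    intro u hu v hv huv
    have := huv.symm
    have := huv.ne
    have h1 : ¬ H.Adj (g q') Y' := fun h => hY' h.symm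
    have h2 : ¬ H.Adj X' Y' := fun h => hnYX' h.symm
    grind
  · simp only [Finset.mem_insert, Finset.mem_singleton, not_or]
    grind
  · grind

theorem exists_map_of_card_le [Nonempty V] {L : Finset W} {X : Finset V} (h : L.card ≤ X.card) :
    ∃ f : W → V, (∀ w ∈ L, f w ∈ X) ∧ ∀ u ∈ L, ∀ v ∈ L, f u = f v → u = v := by
  obtain ⟨f, hmaps, hinj⟩ := L.finite_toSet.exists_injOn_of_encard_le (t := (X : Set V))
    (by simpa using h)
  exact ⟨f, fun w hw => by simpa using hmaps hw, fun u hu v hv huv =>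
    hinj (by simpa using hu) (by simpa using hv) huv⟩

theorem packs_of_common_neighbor {l p q l' p' q' : W} (hp : IsPendantPath T l p q)
    (hp' : IsPendantPath T l' p' q') (hne : p ≠ p') (hnadj : ¬ T.Adj p p') {g : W → V}
    (hinj : ∀ u ∉ ({l, l'} : Finset W), ∀ v ∉ ({l, l'} : Finset W), g u = g v → u = v)
    (hadj : ∀ u ∉ ({l, l'} : Finset W), ∀ v ∉ ({l, l'} : Finset W),
      T.Adj u v → ¬ H.Adj (g u) (g v)) {a b x y : V} (hdis : [a, b, x, y].Nodup)
    (hfree : ∀ w ∉ ({l, l'} : Finset W), g w ∉ [a, b, x, y]) {s r : V} (hsr : s ≠ r)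
    (hNy : ∀ v, H.Adj y v ↔ v = s ∨ v = g p) (hNx : ∀ v, H.Adj x v ↔ v = r ∨ v = g p) :
    Packs T H := by
  obtain ⟨h1, h2, h3, h4, h5, h6, h7⟩ := hp.ne_of_not_adj hp' hne hnadj
  have build : ∀ x y s r : V, [a, b, x, y].Nodup →
      (∀ w ∉ ({l, l'} : Finset W), g w ∉ [a, b, x, y]) → (∀ v, H.Adj y v ↔ v = s ∨ v = g p) →
      (∀ v, H.Adj x v ↔ v = r ∨ v = g p) → g q ≠ s → g p' ≠ r → Packs T H := by
    intro x y s r hdis hfree hNy hNx hq hp'r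
    have hpq := hp.1.ne
    have hpl := hp.2.1.ne
    have hlq := hp.2.2.1
    have hpq' := hp'.1
    have hpl' := hp'.2.1.ne
    have hlq' := hp'.2.2.1
    simp only [Finset.mem_insert, Finset.mem_singleton, not_or] at hinj hadj hfree
    have hgq := hinj p ⟨hpl, h2⟩ q ⟨hlq.symm, h6⟩
    have hgp := hinj p ⟨hpl, h2⟩ p' ⟨h3.symm, hpl'⟩
    have hxp' : ¬ H.Adj (g p') x := by
      rw [H.adj_comm, hNx]
      grind
    have hY' := hadj p' ⟨h3.symm, hpl'⟩ q' ⟨h7, hlq'.symm⟩ hpq'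
    have hyq : ¬ H.Adj y (g q) := by
      rw [hNy]
      grind
    have hfp := hfree p ⟨hpl, h2⟩
    have hfp' := hfree p' ⟨h3.symm, hpl'⟩
    have fin : ∀ X, X = a ∨ X = b → X ≠ s → Packs T H := by
      intro X hX hXs
      refine packs_of_pendantPaths hp hp' hne hnadj (g := g) (Y := y) (X := X) (Y' := g p')
        (X' := x) ?_ ?_ ?_ ?_ ?_ hyq hxp' hY'
      · grind
      · grind
      · grind
      · intro w hw
        have := hfree w (by grind)
        have := hinj w (by grind) p' ⟨h3.symm, hpl'⟩
        grind
      · rw [hNy]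
        grind
    by_cases has : a = s
    · exact fin b (Or.inr rfl) (by grind)
    · exact fin a (Or.inl rfl) has
  by_cases hc : g q ≠ s ∧ g p' ≠ r
  · exact build x y s r hdis hfree hNy hNx hc.1 hc.2
  · have hqp' : g q ≠ g p' := fun h =>
      h4 (hinj q (by simp [hp.2.2.1.symm, h6]) p' (by simp [h3.symm, hp'.2.1.ne]) h)
    exact build y x r s (by grind) (fun w hw => by have := hfree w hw; grind) hNx hNy
      (by grind) (by grind)

theorem packs_of_common_vertex {l p q l' p' q' : W} (hp : IsPendantPath T l p q)
    (hp' : IsPendantPath T l' p' q') (hne : p ≠ p') (hnadj : ¬ T.Adj p p') {g : W → V}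
    (hinj : ∀ u ∉ ({l, l'} : Finset W), ∀ v ∉ ({l, l'} : Finset W), g u = g v → u = v)
    (hadj : ∀ u ∉ ({l, l'} : Finset W), ∀ v ∉ ({l, l'} : Finset W),
      T.Adj u v → ¬ H.Adj (g u) (g v)) {a x y : V} (hdis : [a, x, y].Nodup)
    (hfree : ∀ w ∉ ({l, l'} : Finset W), g w ∉ [a, x, y])
    (hN : ∀ v, H.Adj y v ↔ v = g p ∨ v = g p') (hx : ¬ H.Adj x (g p')) : Packs T H := by
  obtain ⟨h1, h2, h3, h4, h5, h6, h7⟩ := hp.ne_of_not_adj hp' hne hnadj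
  have hpS : p ∉ ({l, l'} : Finset W) := by simp [hp.2.1.ne, h2]
  have hpS' : p' ∉ ({l, l'} : Finset W) := by simp [hp'.2.1.ne, h3.symm]
  have hqS : q ∉ ({l, l'} : Finset W) := by simp [hp.2.2.1.symm, h6]
  have hqS' : q' ∉ ({l, l'} : Finset W) := by simp [hp'.2.2.1.symm, h7]
  have hY' := hadj p' hpS' q' hqS' hp'.1
  have hfp := hfree p hpS
  have hfp' := hfree p' hpS'
  have hqp := hinj q hqS p hpS
  have hqp' := hinj q hqS p' hpS'
  have hpq := hp.1.ne
  have hyq : ¬ H.Adj y (g q) := by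
    rw [hN]
    grind
  have hya : ¬ H.Adj y a := by
    rw [hN]
    grind
  simp only [List.nodup_cons, List.mem_cons, List.not_mem_nil, or_false, not_or, not_false_eq_true,
    List.nodup_nil, and_true] at hdis hfree hfp hfp'
  refine packs_of_pendantPaths hp hp' hne hnadj (g := g) (Y := y) (X := a) (Y' := g p')
    (X' := x) ?_ ?_ ?_ ?_ hya hyq (fun h => hx h.symm) hY'
  · exact fun u hu v hv => hinj u (by grind) v (by grind)
  · exact fun u hu v hv => hadj u (by grind) v (by grind)
  · simp only [List.nodup_cons, List.mem_cons, List.not_mem_nil, or_false, not_or,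
      not_false_eq_true, List.nodup_nil, and_true]
    grind
  · intro w hw
    have := hfree w (by grind)
    have := hinj w (by grind) p' hpS'
    simp only [List.mem_cons, List.not_mem_nil, or_false, not_or]
    grind

theorem packs_of_new_leaves {l p q l' p' q' : W} (hp : IsPendantPath T l p q)
    (hp' : IsPendantPath T l' p' q') (hne : p ≠ p') (hnadj : ¬ T.Adj p p') {g : W → V}
    (hinj : ∀ u ∉ ({l, l'} : Finset W), ∀ v ∉ ({l, l'} : Finset W), g u = g v → u = v)
    (hadj : ∀ u ∉ ({l, l'} : Finset W), ∀ v ∉ ({l, l'} : Finset W),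
      T.Adj u v → ¬ H.Adj (g u) (g v)) {x y : V} (hxy : x ≠ y)
    (hfree : ∀ w ∉ ({l, l'} : Finset W), g w ≠ x ∧ g w ≠ y)
    (hx : ¬ H.Adj x (g p)) (hy : ¬ H.Adj y (g p')) : Packs T H := by
  obtain ⟨h1, h2, h3, h4, h5, h6, h7⟩ := hp.ne_of_not_adj hp' hne hnadj
  have hpS : p ∉ ({l, l'} : Finset W) := by simp [hp.2.1.ne, h2]
  have hpS' : p' ∉ ({l, l'} : Finset W) := by simp [hp'.2.1.ne, h3.symm]
  have hY := hadj p hpS q (by simp [hp.2.2.1.symm, h6]) hp.1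
  have hY' := hadj p' hpS' q' (by simp [hp'.2.2.1.symm, h7]) hp'.1
  have hpp : g p ≠ g p' := fun h => hne (hinj p hpS p' hpS' h)
  have hfp := hfree p hpS
  have hfp' := hfree p' hpS'
  refine packs_of_pendantPaths hp hp' hne hnadj (g := g) (Y := g p) (X := x) (Y' := g p')
    (X' := y) ?_ ?_ ?_ ?_ (fun h => hx h.symm) hY (fun h => hy h.symm) hY'
  · exact fun u hu v hv => hinj u (by grind) v (by grind)
  · exact fun u hu v hv => hadj u (by grind) v (by grind)
  · simp only [List.nodup_cons, List.mem_cons, List.not_mem_nil, or_false, not_or,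
      not_false_eq_true, List.nodup_nil, and_true]
    grind
  · intro w hw
    have := hfree w (by grind)
    have := hinj w (by grind) p hpS
    have := hinj w (by grind) p' hpS'
    simp only [List.mem_cons, List.not_mem_nil, or_false, not_or]
    grind

variable [Fintype V]

theorem card_le_degree {u : V} {s : Finset V} (hs : ∀ v ∈ s, H.Adj u v) : s.card ≤ H.degree u := by
  rw [← card_neighborFinset_eq_degree]
  exact Finset.card_le_card fun v hv => by simpa using hs v hv

theorem degree_eq_two {y s t : V} (hst : s ≠ t) (hN : ∀ v, H.Adj y v ↔ v = s ∨ v = t) :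
    H.degree y = 2 := by
  rw [← card_neighborFinset_eq_degree, ← Finset.card_pair hst]
  congr 1
  ext v
  simp [hN]

theorem exists_of_degree_eq_two {y : V} (h : H.degree y = 2) :
    ∃ s t, s ≠ t ∧ ∀ v, H.Adj y v ↔ v = s ∨ v = t := by
  rw [← card_neighborFinset_eq_degree, Finset.card_eq_two] at h
  obtain ⟨s, t, hst, h⟩ := h
  exact ⟨s, t, hst, fun v => by rw [← mem_neighborFinset, h]; simp⟩

theorem degreeSumAvoiding_singleton (y : V) :
    H.degreeSumAvoiding {y} + 2 * H.degree y = ∑ v, H.degree v := by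
  rw [← degreeSumAvoiding_empty, ← degreeAvoiding_empty,
    degreeSumAvoiding_insert (Finset.notMem_empty y), insert_empty_eq]

theorem degreeSumAvoiding_pair {x y : V} (hxy : x ≠ y) :
    H.degreeSumAvoiding {x, y} + 2 * H.degree x + 2 * H.degree y =
      (∑ v, H.degree v) + if H.Adj x y then 2 else 0 := by
  have h1 := degreeSumAvoiding_singleton (H := H) y
  have h2 := degreeSumAvoiding_insert (H := H) (R := {y}) (x := x) (by simpa using hxy)
  have h3 := degreeAvoiding_insert (H := H) (Finset.notMem_empty y) x
  rw [insert_empty_eq, degreeAvoiding_empty] at h3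
  split_ifs at * <;> omega

theorem degreeSumAvoiding_neighbors {y s t : V} (hst : s ≠ t)
    (hN : ∀ v, H.Adj y v ↔ v = s ∨ v = t) :
    H.degreeSumAvoiding {y, s, t} + 2 * H.degree s + 2 * H.degree t =
      (∑ v, H.degree v) + if H.Adj s t then 2 else 0 := by
  have hys : H.Adj y s := by simp [hN]
  have hyt : H.Adj y t := by simp [hN]
  have h1 := degreeSumAvoiding_pair (H := H) hst
  have h2 := degreeSumAvoiding_insert (H := H) (R := {s, t}) (x := y)
    (by simp [hys.ne, hyt.ne])
  have h3 : H.degreeAvoiding {s, t} y = 0 := by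
    unfold degreeAvoiding
    rw [Finset.card_eq_zero, Finset.filter_eq_empty_iff]
    intro v _
    rw [hN]
    simp only [Finset.mem_insert, Finset.mem_singleton]
    tauto
  omega

/-- A vertex of degree two lying in a triangle, or with both neighbors of degree at most two. -/
theorem packs_of_degree_two (hdel : DeletionProperty T H) {p q : W} (hp : IsPendantStar T p q)
    (hsum : ∑ v, H.degree v < 3 * Fintype.card V) {y s t : V} (hst : s ≠ t)
    (hN : ∀ v, H.Adj y v ↔ v = s ∨ v = t)
    (hside : H.Adj s t ∨ (H.degree s ≤ 2 ∧ H.degree t ≤ 2)) : Packs T H := by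
  obtain ⟨hpq, ⟨l, hpl, hlq⟩, hleaf⟩ := hp
  have hl := hleaf l hpl hlq
  have hlp := hpl.ne
  have hR := degreeSumAvoiding_singleton (H := H) y
  rw [degree_eq_two hst hN] at hR
  obtain ⟨g, a, b, ⟨hinj, hgR, hadj⟩, hab, haR, hbR, hfree⟩ :=
    hdel {l} {y} (by simp) (by simp) ⟨fun w => if w = l then p else w, by grind, by grind, by
      intro u v huv
      have := hl u
      have := hl v
      have := huv.symm
      grind⟩ (by rw [Finset.card_singleton]; omega)
  simp only [Finset.mem_singleton] at hinj hgR hadj haR hbR hfree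
  have keep : ∀ X, X ≠ g p → (∀ w, w ≠ l → w ≠ p → g w ≠ X) → ¬ H.Adj (g p) X → Packs T H := by
    intro X hX hfr hn
    exact packs_of_leaf hpl hl hinj hadj (Y := g p) (X := X) hX.symm
      (fun w hwl hwp => ⟨fun h => hwp (hinj w hwl p hlp h), hfr w hwl hwp⟩) hn
      (fun w hwl hpw => hadj p hlp w hwl hpw)
  have hgp := hfree p hlp
  by_cases hy : H.Adj (g p) y
  swap
  · exact keep y (Ne.symm (hgR p hlp)) (fun w hw _ => hgR w hw) hy
  by_cases ha : H.Adj (g p) a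
  swap
  · exact keep a hgp.1.symm (fun w hw _ => (hfree w hw).1) ha
  by_cases hb : H.Adj (g p) b
  swap
  · exact keep b hgp.2.symm (fun w hw _ => (hfree w hw).2) hb
  have h3 : 3 ≤ H.degree (g p) := by
    have := card_le_degree (H := H) (u := g p) (s := {y, a, b}) (by simp [hy, ha, hb])
    rwa [Finset.card_eq_three.2 ⟨y, a, b, haR ∘ Eq.symm, hbR ∘ Eq.symm, hab, rfl⟩] at this
  have hps : g p = s ∨ g p = t := (hN _).1 hy.symm
  have hadjst : H.Adj s t := hside.resolve_right (by rintro ⟨h, h'⟩; grind)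
  have hts := hadjst.symm
  have move : ∀ X, X ≠ y → ¬ H.Adj y X → (∀ w, w ≠ l → w ≠ p → g w ≠ X) → Packs T H := by
    intro X hX hyX hfr
    refine packs_of_leaf hpl hl hinj hadj (Y := y) (X := X) hX.symm
      (fun w hwl hwp => ⟨hgR w hwl, hfr w hwl hwp⟩) hyX ?_
    intro w hwl hpw hyw
    have h1 := hadj p hlp w hwl hpw
    have h2 := hinj p hlp w hwl
    have := hpw.ne
    grind
  by_cases hya : H.Adj y a
  · refine move b hbR ?_ (fun w hw _ => (hfree w hw).2)
    grind
  · exact move a haR hya (fun w hw _ => (hfree w hw).1)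

/-- Two vertices of degree two with distinct neighborhoods. -/
theorem packs_of_neighborhoods_ne (hdel : DeletionProperty T H) {l p q l' p' q' : W}
    (hp : IsPendantPath T l p q) (hp' : IsPendantPath T l' p' q') (hne : p ≠ p')
    (hnadj : ¬ T.Adj p p') (hsum : ∑ v, H.degree v < 3 * Fintype.card V) {x y : V}
    (hx : H.degree x = 2) (hy : H.degree y = 2)
    (hN : ∃ v, ¬ (H.Adj x v ↔ H.Adj y v)) : Packs T H := by
  have hxy : x ≠ y := by
    rintro rfl
    simp at hN
  obtain ⟨h1, h2, h3, h4, h5, h6, h7⟩ := hp.ne_of_not_adj hp' hne hnadj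
  have hc := Finset.card_pair hxy
  have hsum' := degreeSumAvoiding_pair (H := H) hxy
  have hp0 := hp
  have hp0' := hp'
  obtain ⟨hpq, hpl, hlq, hl, hpn⟩ := hp0
  obtain ⟨hpq', hpl', hlq', hl', hpn'⟩ := hp0'
  have hll := hpl.ne
  have hll' := hpl'.ne
  obtain ⟨g, a, b, ⟨hinj, hgR, hadj⟩, hab, haR, hbR, hfree⟩ := hdel {l, l'} {x, y} (by simp)
    (by rw [hc, Finset.card_pair h1])
    ⟨fun w => if w = l then p else if w = l' then p' else w, by grind, by grind, by
      intro u v huv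
      have := hl u
      have := hl v
      have := hl' u
      have := hl' v
      have := huv.symm
      grind⟩ (by rw [hc]; split_ifs at hsum' <;> omega)
  have hpS : p ∉ ({l, l'} : Finset W) := by simp [hll, h2]
  have hpS' : p' ∉ ({l, l'} : Finset W) := by simp [hll', h3.symm]
  have hqS : q ∉ ({l, l'} : Finset W) := by simp [hlq.symm, h6]
  have hqS' : q' ∉ ({l, l'} : Finset W) := by simp [hlq'.symm, h7]
  obtain ⟨s, t, hst, hNy⟩ := exists_of_degree_eq_two hy
  obtain ⟨r, c, hrc, hNx⟩ := exists_of_degree_eq_two hx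
  have hdis : [a, b, x, y].Nodup := by grind
  have hfree' : ∀ w ∉ ({l, l'} : Finset W), g w ∉ [a, b, x, y] := by grind
  have common : ∀ z, H.Adj x z → H.Adj y z →
      ∃ s' r', s' ≠ r' ∧ (∀ v, H.Adj y v ↔ v = s' ∨ v = z) ∧ ∀ v, H.Adj x v ↔ v = r' ∨ v = z := by
    intro z hxz hyz
    obtain ⟨v, hv⟩ := hN
    refine ⟨if z = s then t else s, if z = r then c else r, ?_, ?_, ?_⟩ <;> grind
  by_cases hu : H.Adj x (g p) ∧ H.Adj y (g p)
  · obtain ⟨s', r', hsr, hNy', hNx'⟩ := common _ hu.1 hu.2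
    exact packs_of_common_neighbor hp hp' hne hnadj hinj hadj hdis hfree' hsr hNy' hNx'
  by_cases hu' : H.Adj x (g p') ∧ H.Adj y (g p')
  · obtain ⟨s', r', hsr, hNy', hNx'⟩ := common _ hu'.1 hu'.2
    rw [Finset.pair_comm] at hinj hadj hfree'
    exact packs_of_common_neighbor hp' hp hne.symm (fun h => hnadj h.symm) hinj hadj hdis hfree'
      hsr hNy' hNx'
  have hgx : ∀ w ∉ ({l, l'} : Finset W), g w ≠ x ∧ g w ≠ y := by
    intro w hw
    have := hgR w hw
    simpa [not_or] using this
  by_cases hA : ¬ H.Adj x (g p) ∧ ¬ H.Adj y (g p')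
  · exact packs_of_new_leaves hp hp' hne hnadj hinj hadj hxy hgx hA.1 hA.2
  by_cases hB : ¬ H.Adj y (g p) ∧ ¬ H.Adj x (g p')
  · exact packs_of_new_leaves hp hp' hne hnadj hinj hadj hxy.symm
      (fun w hw => (hgx w hw).symm) hB.1 hB.2
  have nbr : ∀ z, H.degree z = 2 → H.Adj z (g p) → H.Adj z (g p') →
      ∀ v, H.Adj z v ↔ v = g p ∨ v = g p' := by
    intro z hz h h'
    obtain ⟨s, t, -, hN⟩ := exists_of_degree_eq_two hz
    rw [hN] at h h'
    intro v
    rw [hN]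
    grind
  simp only [Finset.mem_insert, Finset.mem_singleton, not_or] at haR hbR
  by_cases hyp : H.Adj y (g p)
  · have hyp' : H.Adj y (g p') := not_not.1 fun h => hA ⟨fun h' => hu ⟨h', hyp⟩, h⟩
    exact packs_of_common_vertex hp hp' hne hnadj hinj hadj (a := a) (x := x) (y := y)
      (by simp [haR, hxy]) (fun w hw => by simp [hgx w hw, hfree w hw])
      (nbr y hy hyp hyp') (fun h => hu' ⟨h, hyp'⟩)
  · have hxp' : H.Adj x (g p') := not_not.1 fun h => hB ⟨hyp, h⟩
    have hyp' : ¬ H.Adj y (g p') := fun h => hu' ⟨hxp', h⟩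
    have hxp : H.Adj x (g p) := not_not.1 fun h => hA ⟨h, hyp'⟩
    exact packs_of_common_vertex hp hp' hne hnadj hinj hadj (a := a) (x := y) (y := x)
      (by simp [haR, hxy.symm]) (fun w hw => by simp [hgx w hw, hfree w hw])
      (nbr x hx hxp hxp') hyp'

theorem packs_or_exists_adj (hdel : DeletionProperty T H) {l p q l' p' q' : W}
    (hp : IsPendantPath T l p q) (hp' : IsPendantPath T l' p' q') (hne : p ≠ p')
    (hnadj : ¬ T.Adj p p') (hsum : ∑ v, H.degree v < 3 * Fintype.card V) {y s t : V} (hst : s ≠ t)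
    (hN : ∀ v, H.Adj y v ↔ v = s ∨ v = t) (hnst : ¬ H.Adj s t)
    (hd : 5 ≤ H.degree s + H.degree t) :
    Packs T H ∨ ∃ u v a b, [u, v, y, a].Nodup ∧ [s, t, a, b].Nodup ∧
      (∀ z ∈ [s, t, a, b], H.Adj u z) ∧
      H.Adj v s ∧ H.Adj v t ∧ (H.Adj v a ∨ H.Adj a t) := by
  have hys : H.Adj y s := by simp [hN]
  have hyt : H.Adj y t := by simp [hN]
  have hys' := hys.ne
  have hyt' := hyt.ne
  obtain ⟨h1, h2, h3, h4, h5, h6, h7⟩ := hp.ne_of_not_adj hp' hne hnadj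
  have hc : ({y, s, t} : Finset V).card = 3 :=
    Finset.card_eq_three.2 ⟨y, s, t, hys', hyt', hst, rfl⟩
  have hsum' := degreeSumAvoiding_neighbors hst hN
  rw [if_neg hnst] at hsum'
  have hp0 := hp
  have hp0' := hp'
  obtain ⟨hpq, hpl, hlq, hl, hpn⟩ := hp0
  obtain ⟨hpq', hpl', hlq', hl', hpn'⟩ := hp0'
  have hpl0 := hpl.ne
  have hpl0' := hpl'.ne
  have hpq0 := hpq.ne
  have hpq0' := hpq'.ne
  obtain ⟨g, a, b, ⟨hinj, hgR, hadj⟩, hab, haR, hbR, hfree⟩ := hdel {l, p, l'} {y, s, t} (by simp)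
    (by rw [hc, Finset.card_eq_three.2 ⟨l, p, l', hpl0.symm, h1, h2, rfl⟩])
    ⟨fun w => if w = l ∨ w = p then q else if w = l' then p' else w, by grind, by grind, by
      intro u v huv
      have := hl u
      have := hl v
      have := hl' u
      have := hl' v
      have := hpn u
      have := hpn v
      have := huv.symm
      grind⟩ (by rw [hc]; omega)
  have hpS : p' ∉ ({l, p, l'} : Finset W) := by simp [h3.symm, hne.symm, hpl0']
  have hqS : q ∉ ({l, p, l'} : Finset W) := by simp [hlq.symm, hpq0.symm, h6]
  have hqS' : q' ∉ ({l, p, l'} : Finset W) := by simp [h7, h5, hlq'.symm]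
  have hu := hadj p' hpS q' hqS' hpq'
  have hvu : g q ≠ g p' := fun h => h4 (hinj q hqS p' hpS h)
  simp only [Finset.mem_insert, Finset.mem_singleton, not_or] at haR hbR
  have hg : ∀ w ∉ ({l, p, l'} : Finset W), g w ≠ y ∧ g w ≠ s ∧ g w ≠ t ∧ g w ≠ a ∧ g w ≠ b := by
    intro w hw
    have := hgR w hw
    simp only [Finset.mem_insert, Finset.mem_singleton, not_or] at this
    exact ⟨this.1, this.2.1, this.2.2, hfree w hw⟩
  have hgp := hg p' hpS
  have hgq := hg q hqS
  have hgq' := hg q' hqS'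
  have hyv : ¬ H.Adj y (g q) := by simp [hN, hgq]
  have hyv' : ¬ H.Adj y (g q') := by simp [hN, hgq']
  have hya : ¬ H.Adj y a := by simp [hN, haR]
  have hyb : ¬ H.Adj y b := by simp [hN, hbR]
  have build : ∀ Y X Y' X', [Y, X, Y', X'].Nodup →
      (∀ Z ∈ [Y, X, Y', X'], Z ∈ [g p', y, s, t, a, b]) → ¬ H.Adj Y X → ¬ H.Adj Y (g q) →
      ¬ H.Adj Y' X' → ¬ H.Adj Y' (g q') → Packs T H := by
    intro Y X Y' X' hdis hmem hYX hY hYX' hY'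
    have hsub : ∀ w ∉ ({l, p, l', p'} : Finset W), w ∉ ({l, p, l'} : Finset W) ∧ w ≠ p' := by
      intro w hw
      simp only [Finset.mem_insert, Finset.mem_singleton, not_or] at hw ⊢
      exact ⟨⟨hw.1, hw.2.1, hw.2.2.1⟩, hw.2.2.2⟩
    refine packs_of_pendantPaths hp hp' hne hnadj
      (fun u hu v hv => hinj u (hsub u hu).1 v (hsub v hv).1)
      (fun u hu v hv => hadj u (hsub u hu).1 v (hsub v hv).1) hdis ?_ hYX hY hYX' hY'
    intro w hw hwm
    obtain ⟨hw1, hw2⟩ := hsub w hw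
    have h := hmem _ hwm
    have := hg w hw1
    simp only [List.mem_cons, List.not_mem_nil, or_false] at h
    rcases h with h | h
    · exact hw2 (hinj w hw1 p' hpS h)
    · tauto
  by_cases hA : ∀ z ∈ [s, t, a, b], H.Adj (g p') z
  swap
  · left
    push Not at hA
    obtain ⟨z, hz, hzu⟩ := hA
    by_cases hza : z = a
    · subst hza
      exact build y b (g p') z (by simp; grind) (by simp) hyb hyv hzu hu
    · refine build y a (g p') z ?_ ?_ hya hyv hzu hu
      · simp only [List.mem_cons, List.not_mem_nil, or_false] at hz
        simp
        grind
      · simp only [List.mem_cons, List.not_mem_nil, or_false] at hz ⊢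
        grind
  by_cases hvs : H.Adj (g q) s
  swap
  · exact Or.inl (build s t y a (by simp; grind) (by simp) hnst (fun h => hvs h.symm) hya hyv')
  by_cases hvt : H.Adj (g q) t
  swap
  · exact Or.inl (build t s y a (by simp; grind) (by simp) (fun h => hnst h.symm)
      (fun h => hvt h.symm) hya hyv')
  by_cases hva : H.Adj (g q) a ∨ H.Adj a t
  swap
  · rw [not_or] at hva
    exact Or.inl (build a t y b (by simp; grind) (by simp) hva.2 (fun h => hva.1 h.symm) hyb hyv')
  exact Or.inr ⟨g p', g q, a, b, by simp; grind, by simp; grind, hA, hvs, hvt, hva⟩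

theorem add_degree_le_of_two_le_degree (hmin : ∀ v, 2 ≤ H.degree v) {s : Finset V} :
    ∑ v ∈ s, H.degree v + 3 * Fintype.card V ≤
      ∑ v, H.degree v + 3 * s.card + (Finset.univ.filter fun v => H.degree v = 2).card := by
  have h1 := Finset.sum_add_sum_compl s fun v => H.degree v
  have h2 : ∑ _v ∈ sᶜ, 3 ≤ ∑ v ∈ sᶜ, (H.degree v + if H.degree v = 2 then 1 else 0) :=
    Finset.sum_le_sum fun v _ => by
      have := hmin v
      split_ifs <;> omega
  rw [Finset.sum_add_distrib, ← Finset.card_filter, Finset.sum_const, smul_eq_mul] at h2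
  have h3 := Finset.card_le_card
    (Finset.filter_subset_filter (fun v => H.degree v = 2) (Finset.subset_univ sᶜ))
  have h4 := Finset.card_add_card_compl s
  omega

theorem packs_of_pendantPaths_of_two_le_degree (hdel : DeletionProperty T H) {l p q l' p' q' : W}
    (hp : IsPendantPath T l p q) (hp' : IsPendantPath T l' p' q') (hstar : IsPendantStar T p q)
    (hne : p ≠ p') (hnadj : ¬ T.Adj p p') (hsum : ∑ v, H.degree v < 3 * Fintype.card V)
    (hmin : ∀ v, 2 ≤ H.degree v) {y : V} (hy : H.degree y = 2) : Packs T H := by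
  by_contra hpack
  obtain ⟨s, t, hst, hN⟩ := exists_of_degree_eq_two hy
  have hys : H.Adj y s := by simp [hN]
  have hyt : H.Adj y t := by simp [hN]
  have hnbr : ∀ z, H.degree z = 2 → ∀ v, H.Adj z v ↔ v = s ∨ v = t := by
    intro z hz v
    rw [← hN]
    by_contra h
    exact hpack (packs_of_neighborhoods_ne hdel hp hp' hne hnadj hsum hz hy ⟨v, h⟩)
  have hs : 3 ≤ H.degree s := by
    by_contra h
    have := hmin s
    simpa using (hnbr s (by omega) s).2 (Or.inl rfl)
  have ht : 3 ≤ H.degree t := by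
    by_contra h
    have := hmin t
    simpa using (hnbr t (by omega) t).2 (Or.inr rfl)
  have hnst : ¬ H.Adj s t := fun h =>
    hpack (packs_of_degree_two hdel hstar hsum hst hN (Or.inl h))
  obtain ⟨u, v, a, b, huv, hstab, hu, hvs, hvt, hva⟩ :=
    (packs_or_exists_adj hdel hp hp' hne hnadj hsum hst hN hnst (by omega)).resolve_left hpack
  simp only [List.nodup_cons, List.mem_cons, List.not_mem_nil, or_false, not_or, not_false_eq_true,
    List.nodup_nil, and_true] at huv hstab
  have hus : H.Adj u s := hu s (by simp)
  have hut : H.Adj u t := hu t (by simp)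
  have hua : H.Adj u a := hu a (by simp)
  have hub : H.Adj u b := hu b (by simp)
  have hu4 : 4 ≤ H.degree u := by
    have h := card_le_degree (H := H) (u := u) (s := {s, t, a, b}) (by simp [hus, hut, hua, hub])
    rwa [Finset.card_insert_of_notMem (by simp [hstab]),
      Finset.card_eq_three.2 ⟨t, a, b, hstab.2.1.1, hstab.2.1.2, hstab.2.2, rfl⟩] at h
  set D := Finset.univ.filter fun v => H.degree v = 2 with hD
  have hmem : ∀ z, z ∈ D ↔ H.degree z = 2 := by simp [hD]
  have huD : u ∉ D := by
    rw [hmem]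
    omega
  have hDs : ∀ z ∈ insert u D, H.Adj s z := by
    intro z hz
    rcases Finset.mem_insert.1 hz with rfl | hz
    · exact hus.symm
    · exact ((hnbr z ((hmem z).1 hz) s).2 (Or.inl rfl)).symm
  have hDt : ∀ z ∈ insert u D, H.Adj t z := by
    intro z hz
    rcases Finset.mem_insert.1 hz with rfl | hz
    · exact hut.symm
    · exact ((hnbr z ((hmem z).1 hz) t).2 (Or.inr rfl)).symm
  have h1 := card_le_degree hDs
  have h2 := card_le_degree hDt
  rw [Finset.card_insert_of_notMem huD] at h1 h2
  have h3 := add_degree_le_of_two_le_degree hmin (s := {u, s, t})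
  rw [Finset.card_eq_three.2 ⟨u, s, t, hus.ne, hut.ne, hst, rfl⟩,
    Finset.sum_insert (by simp [hus.ne, hut.ne]), Finset.sum_pair hst, ← hD] at h3
  by_cases hvD : v ∈ D
  · have hva' : ¬ H.Adj v a := by
      rw [hnbr v ((hmem v).1 hvD)]
      grind
    have hat := hva.resolve_left hva'
    have h := card_le_degree (H := H) (u := t) (s := {u, v, y, a})
      (by simp [hut.symm, hvt.symm, hyt.symm, hat.symm])
    rw [Finset.card_insert_of_notMem (by simp [huv]),
      Finset.card_eq_three.2 ⟨v, y, a, huv.2.1.1, huv.2.1.2, huv.2.2, rfl⟩] at h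
    omega
  · have h := card_le_degree (H := H) (u := s) (s := insert v (insert u D))
      (fun z hz => by
        rcases Finset.mem_insert.1 hz with rfl | hz
        · exact hvs.symm
        · exact hDs z hz)
    rw [Finset.card_insert_of_notMem (by simp [hvD, Ne.symm huv.1.1]),
      Finset.card_insert_of_notMem huD] at h
    omega

variable [Fintype W]

theorem IsPendantStar.card_leaves_pos {p q : W} (hp : IsPendantStar T p q) :
    0 < (Finset.univ.filter fun w => T.Adj p w ∧ w ≠ q).card :=
  Finset.card_pos.2 (hp.2.1.imp fun l hl => by simpa using hl)

/-- Place the center of a pendant star on `y` and delete all neighbors of `y`. -/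
theorem packs_of_pendantStar (hdel : DeletionProperty T H) {p q : W} (hp : IsPendantStar T p q)
    {y : V} {R : Finset V} (hy : y ∈ R) (hN : ∀ v, H.Adj y v → v ∈ R) (hd : H.degree y ≤ 2)
    (hcard : R.card = (Finset.univ.filter fun w => T.Adj p w ∧ w ≠ q).card + 1)
    (hR : H.degreeSumAvoiding R < 3 * (Fintype.card V - R.card)) : Packs T H := by
  obtain ⟨hpq, -, hleaf⟩ := hp
  set L := Finset.univ.filter fun w => T.Adj p w ∧ w ≠ q with hL
  have hmem : ∀ w, w ∈ L ↔ T.Adj p w ∧ w ≠ q := by simp [hL]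
  have hpL : p ∉ L := by simp [hL]
  have hqS : q ∉ insert p L := by simp [hL, hpq.ne.symm]
  have := hpq.ne
  obtain ⟨g, a, b, ⟨hinj, hgR, hadj⟩, hab, haR, hbR, hfree⟩ :=
    hdel (insert p L) R ⟨p, by simp⟩ (by rw [hcard, Finset.card_insert_of_notMem hpL])
      ⟨fun w => if w ∈ insert p L then q else w, by grind, by grind, by
        intro u v huv
        have := hleaf u
        have := hleaf v
        have := huv.symm
        grind⟩ hR
  set X := insert a (insert b (R \ insert y (H.neighborFinset y))) with hX
  have hXcard : L.card ≤ X.card := by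
    have h1 : (insert y (H.neighborFinset y)).card ≤ 3 :=
      (Finset.card_insert_le _ _).trans (by rw [card_neighborFinset_eq_degree]; omega)
    have h2 := Finset.le_card_sdiff (insert y (H.neighborFinset y)) R
    rw [hX, Finset.card_insert_of_notMem (by simp [hab, haR]),
      Finset.card_insert_of_notMem (by simp [hbR])]
    omega
  have hXy : ∀ x ∈ X, x ≠ y ∧ ¬ H.Adj y x := by
    intro x hx
    simp only [hX, Finset.mem_insert, Finset.mem_sdiff, mem_neighborFinset] at hx
    grind
  have hXg : ∀ w ∉ insert p L, g w ∉ X := by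
    intro w hw hx
    have := hgR w hw
    have := hfree w hw
    simp only [hX, Finset.mem_insert, Finset.mem_sdiff] at hx
    grind
  have : Nonempty V := ⟨y⟩
  obtain ⟨h, hmaps, hinjL⟩ := exists_map_of_card_le hXcard
  refine ⟨fun w => if w = p then y else if w ∈ L then h w else g w, fun u v huv => ?_, ?_⟩
  · grind
  · have main : ∀ v, T.Adj p v → ¬ H.Adj y (if v ∈ L then h v else g v) := by
      intro v hv
      grind
    intro u v huv
    have := huv.symm
    have := huv.ne
    have := hleaf u
    have := hleaf v
    by_cases hu : u = p
    · have := main v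
      grind
    by_cases hv : v = p
    · have := main u
      simp only [hu, hv, if_false, if_true]
      exact fun h => this (hv ▸ huv.symm) h.symm
    · grind

theorem IsPendantStar.exists_isPendantPath {p q : W} (hp : IsPendantStar T p q)
    (hcard : (Finset.univ.filter fun w => T.Adj p w ∧ w ≠ q).card = 1) :
    ∃ l, IsPendantPath T l p q := by
  obtain ⟨l, hl⟩ := Finset.card_eq_one.1 hcard
  have hmem : ∀ w, (T.Adj p w ∧ w ≠ q) ↔ w = l := fun w => by
    rw [← Finset.mem_singleton, ← hl]
    simp
  obtain ⟨h1, h2⟩ := (hmem l).2 rfl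
  refine ⟨l, hp.1, h1, h2, hp.2.2 l h1 h2, fun w hw => ?_⟩
  rw [← hmem]
  tauto

/-- The number of leaves of the pendant star exceeds the minimum degree. -/
theorem packs_of_degree_lt (hdel : DeletionProperty T H) {p q : W} (hp : IsPendantStar T p q)
    (hcard : Fintype.card V = Fintype.card W + 2) (hsum : ∑ v, H.degree v < 3 * Fintype.card V)
    {y : V} (hmin : ∀ v, H.degree y ≤ H.degree v) (hd : H.degree y ≤ 2)
    (hm : H.degree y < (Finset.univ.filter fun w => T.Adj p w ∧ w ≠ q).card) : Packs T H := by
  set m := (Finset.univ.filter fun w => T.Adj p w ∧ w ≠ q).card with hm'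
  have hmW : m + 1 ≤ Fintype.card W := by
    rw [hm', ← Finset.card_insert_of_notMem (a := p) (by simp)]
    exact Finset.card_le_univ _
  have hR : ∃ R : Finset V, y ∈ R ∧ (∀ v, H.Adj y v → v ∈ R) ∧ R.card = H.degree y + 1 ∧
      H.degreeSumAvoiding R ≤ 3 * (Fintype.card V - R.card) + 4 := by
    have hc : (insert y (H.neighborFinset y)).card = H.degree y + 1 := by
      rw [Finset.card_insert_of_notMem (by simp), card_neighborFinset_eq_degree]
    refine ⟨insert y (H.neighborFinset y), by simp, fun v hv => by simp [hv], hc, ?_⟩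
    rw [hc]
    rcases (by omega : H.degree y = 0 ∨ H.degree y = 1 ∨ H.degree y = 2) with h | h | h
    · have h0 := h
      rw [← card_neighborFinset_eq_degree, Finset.card_eq_zero] at h0
      have := degreeSumAvoiding_singleton (H := H) y
      rw [h0, insert_empty_eq]
      omega
    · have h0 := h
      rw [← card_neighborFinset_eq_degree, Finset.card_eq_one] at h0
      obtain ⟨s, hs⟩ := h0
      have hys : H.Adj y s := by rw [← mem_neighborFinset, hs]; simp
      have h1 := degreeSumAvoiding_pair (H := H) hys.ne
      rw [if_pos hys] at h1
      have := hmin s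
      rw [hs]
      omega
    · obtain ⟨s, t, hst, hN⟩ := exists_of_degree_eq_two h
      have h0 : H.neighborFinset y = {s, t} := by ext; simp [hN]
      have h1 := degreeSumAvoiding_neighbors hst hN
      have := hmin s
      have := hmin t
      rw [h0]
      split_ifs at h1 <;> omega
  obtain ⟨R, hyR, hN, hRc, hRs⟩ := hR
  obtain ⟨Z, hRZ, hZc, hZs⟩ :=
    exists_superset_degreeSumAvoiding_lt (m - H.degree y - 1) (by omega) hRs
  exact packs_of_pendantStar hdel hp (hRZ hyR) (fun v hv => hRZ (hN v hv)) hd (by omega) hZs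

theorem packs_of_degree_eq_one (hdel : DeletionProperty T H) {p q : W} (hp : IsPendantStar T p q)
    (hsum : ∑ v, H.degree v < 3 * Fintype.card V) {y : V} (hd : H.degree y = 1)
    (hm : (Finset.univ.filter fun w => T.Adj p w ∧ w ≠ q).card = 1)
    (hcard : 3 ≤ Fintype.card V) : Packs T H := by
  obtain ⟨s, hs⟩ : ∃ s, H.neighborFinset y = {s} := by
    rwa [← Finset.card_eq_one, card_neighborFinset_eq_degree]
  have hN : ∀ v, H.Adj y v ↔ v = s := fun v => by rw [← mem_neighborFinset, hs]; simp
  have hys : H.Adj y s := by simp [hN]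
  have star : H.degreeSumAvoiding {s, y} < 3 * (Fintype.card V - 2) → Packs T H := by
    intro h
    refine packs_of_pendantStar hdel hp (y := y) (R := {s, y}) (by simp)
      (fun v hv => by simp [(hN v).1 hv]) (by omega) ?_ ?_
    · rw [Finset.card_pair hys.ne.symm, hm]
    · rwa [Finset.card_pair hys.ne.symm]
  by_cases hs3 : 3 ≤ H.degree s
  · have h := degreeSumAvoiding_pair (H := H) hys.ne.symm
    rw [if_pos hys.symm] at h
    exact star (by omega)
  have h1 := degreeSumAvoiding_singleton (H := H) y
  obtain ⟨x, hxy, hx⟩ := exists_degreeSumAvoiding_insert_lt (H := H) (R := {y})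
    (by rw [Finset.card_singleton]; omega) (by rw [Finset.card_singleton]; omega)
  rw [Finset.mem_singleton] at hxy
  by_cases hxs : x = s
  · subst hxs
    rw [Finset.card_pair hxy] at hx
    exact star hx
  obtain ⟨l, hl⟩ := hp.exists_isPendantPath hm
  have hl' := hl
  obtain ⟨hpq, hpl, hlq, hll, hpn⟩ := hl'
  have hpq' := hpq.ne
  have hpl' := hpl.ne
  obtain ⟨g, a, b, ⟨hinj, hgR, hadj⟩, hab, haR, hbR, hfree⟩ := hdel {l, p} {x, y} (by simp)
    (by rw [Finset.card_pair hxy, Finset.card_pair hpl'.symm])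
    ⟨fun w => if w = l ∨ w = p then q else w, by grind, by grind, by
      intro u v huv
      have := hll u
      have := hll v
      have := hpn u
      have := hpn v
      have := huv.symm
      grind⟩ hx
  have hq : q ∉ ({l, p} : Finset W) := by simp [hlq.symm, hpq'.symm]
  by_cases hgq : g q = s
  swap
  · exact packs_of_pendantPath hl hinj hadj (Y := y) (X := x) (Ne.symm hxy) (by grind)
      (by simp [hN, hxs])
      (by simp [hN, hgq])
  have haq := hfree q hq
  have hP : ¬ H.Adj s x ∨ ¬ H.Adj s a := by
    by_contra! h
    have hc := card_le_degree (H := H) (u := s) (s := {y, x, a}) (by simp [hys.symm, h])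
    rw [Finset.card_eq_three.2 ⟨y, x, a, by grind, by grind, by grind, rfl⟩] at hc
    omega
  have build : ∀ P, ¬ H.Adj s P → P ≠ y → P ≠ s → (∀ w ∉ ({l, p} : Finset W), g w ≠ P) →
      Packs T H := by
    intro P hsP hPy hPs hfr
    refine packs_of_pendantPath hl hinj hadj (Y := P) (X := y) hPy
      (fun w hw => ⟨hfr w hw, fun h => hgR w hw (by simp [h])⟩) (fun h => hPs ((hN P).1 h.symm)) ?_
    rw [hgq]
    exact fun h => hsP h.symm
  rcases hP with h | h
  · exact build x h hxy hxs (by grind)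
  · exact build a h (by grind) (by grind) (fun w hw => (hfree w hw).1)

theorem packs_of_pendantStar_of_degree_le (hdel : DeletionProperty T H) {p q : W}
    (hp : IsPendantStar T p q) (hcard : Fintype.card V = Fintype.card W + 2)
    (hsum : ∑ v, H.degree v < 3 * Fintype.card V)
    {y : V} (hmin : ∀ v, H.degree y ≤ H.degree v) (hd : H.degree y ≤ 2)
    (hm : H.degree y ≤ (Finset.univ.filter fun w => T.Adj p w ∧ w ≠ q).card) : Packs T H := by
  rcases hm.lt_or_eq with hlt | heq
  · exact packs_of_degree_lt hdel hp hcard hsum hmin hd hlt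
  have hpos := hp.card_leaves_pos
  have hW : 0 < Fintype.card W := Fintype.card_pos_iff.2 ⟨p⟩
  rcases (by omega : H.degree y = 1 ∨ H.degree y = 2) with h | h
  · exact packs_of_degree_eq_one hdel hp hsum h (by omega) (by omega)
  obtain ⟨s, t, hst, hN⟩ := exists_of_degree_eq_two h
  by_cases hside : H.Adj s t ∨ (H.degree s ≤ 2 ∧ H.degree t ≤ 2)
  · exact packs_of_degree_two hdel hp hsum hst hN hside
  have hys : H.Adj y s := by simp [hN]
  have hyt : H.Adj y t := by simp [hN]
  have hc : ({y, s, t} : Finset V).card = 3 :=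
    Finset.card_eq_three.2 ⟨y, s, t, hys.ne, hyt.ne, hst, rfl⟩
  have h1 := degreeSumAvoiding_neighbors hst hN
  have := hmin s
  have := hmin t
  refine packs_of_pendantStar hdel hp (y := y) (R := {y, s, t}) (by simp)
    (fun v hv => by simpa using Or.inr ((hN v).1 hv)) hd (by omega) ?_
  rw [hc]
  split_ifs at h1 with hs
  · exact absurd (Or.inl hs) hside
  · omega

theorem card_mul_degree_le {y : V} (hmin : ∀ v, H.degree y ≤ H.degree v) :
    Fintype.card V * H.degree y ≤ ∑ v, H.degree v := by
  rw [← smul_eq_mul, ← Finset.card_univ]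
  exact Finset.card_nsmul_le_sum _ _ _ fun v _ => hmin v

theorem exists_not_adj_degree_le {a b : ℕ} (hab : b ≤ a) (hcard : Fintype.card V = a + b + 4)
    (hsum : ∑ v, H.degree v < 3 * Fintype.card V) {y : V}
    (hmin : ∀ v, H.degree y ≤ H.degree v) (hd : H.degree y ≤ 2) :
    ∃ u, u ≠ y ∧ ¬ H.Adj y u ∧ H.degree u ≤ a + 2 := by
  by_contra! hcon
  set N := insert y (H.neighborFinset y) with hN
  have hNc : N.card = H.degree y + 1 := by
    rw [hN, Finset.card_insert_of_notMem (by simp), card_neighborFinset_eq_degree]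
  have hcc := Finset.card_add_card_compl N
  have hlow : ∀ v ∈ Nᶜ, a + 3 ≤ H.degree v := by
    intro v hv
    simp only [hN, Finset.mem_compl, Finset.mem_insert, mem_neighborFinset, not_or] at hv
    exact hcon v hv.1 hv.2
  obtain ⟨v, hv⟩ : Nᶜ.Nonempty := Finset.card_pos.1 (by omega)
  have hb : 1 ≤ b := by
    have h1 := hlow v hv
    simp only [hN, Finset.mem_compl, Finset.mem_insert, mem_neighborFinset, not_or] at hv
    have h2 : H.degree v ≤ ({v, y} : Finset V)ᶜ.card := by
      rw [← card_neighborFinset_eq_degree]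
      refine Finset.card_le_card fun w hw => ?_
      rw [mem_neighborFinset] at hw
      simp only [Finset.mem_compl, Finset.mem_insert, Finset.mem_singleton, not_or]
      exact ⟨hw.ne.symm, fun h => hv.2 (h ▸ hw.symm)⟩
    rw [Finset.card_compl, Finset.card_pair hv.1] at h2
    omega
  have h1 : N.card * H.degree y ≤ ∑ v ∈ N, H.degree v :=
    Finset.card_nsmul_le_sum _ _ _ fun v _ => hmin v
  have h2 : Nᶜ.card * (a + 3) ≤ ∑ v ∈ Nᶜ, H.degree v := Finset.card_nsmul_le_sum _ _ _ hlow
  have h3 := Finset.sum_add_sum_compl N fun v => H.degree v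
  have hNc' : Nᶜ.card = a + b + 3 - H.degree y := by omega
  rw [hNc'] at h2
  rw [hNc] at h1
  generalize H.degree y = d at *
  interval_cases d
  · rw [Nat.sub_zero] at h2
    nlinarith
  · rw [show a + b + 3 - 1 = a + b + 2 by omega] at h2
    nlinarith
  · rw [show a + b + 3 - 2 = a + b + 1 by omega] at h2
    nlinarith

theorem IsDoubleStar.packs {p q : W} {A B : Finset W} (hT : IsDoubleStar T p q A B)
    (hcard : Fintype.card V = Fintype.card W + 2)
    (hsum : ∑ v, H.degree v < 3 * Fintype.card V) {y : V}
    (hmin : ∀ v, H.degree y ≤ H.degree v) (hd : H.degree y ≤ 2) : Packs T H := by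
  wlog hBA : B.card ≤ A.card generalizing p q A B
  · exact this hT.symm (by omega)
  obtain ⟨hpq, hpA, hqA, hpB, hqB, hAB, hcover, hadj⟩ := hT
  have hW : Fintype.card W = A.card + B.card + 2 := by
    have huniv : (Finset.univ : Finset W) = insert p (insert q (A ∪ B)) := by
      ext w
      simpa using hcover w
    rw [← Finset.card_univ, huniv, Finset.card_insert_of_notMem (by simp [hpq, hpA, hpB]),
      Finset.card_insert_of_notMem (by simp [hqA, hqB]), Finset.card_union_of_disjoint hAB]
  obtain ⟨u, huy, hyu, hu⟩ := exists_not_adj_degree_le hBA (by omega) hsum hmin hd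
  have hXc : ({y, u} : Finset V)ᶜ.card = A.card + B.card + 2 := by
    rw [Finset.card_compl, Finset.card_pair huy.symm]
    omega
  rw [← card_neighborFinset_eq_degree] at hu hd
  obtain ⟨B', hB', hB'c⟩ := Finset.exists_subset_card_eq
    (s := ({y, u} : Finset V)ᶜ \ H.neighborFinset u) (n := B.card) (by
      have := Finset.le_card_sdiff (H.neighborFinset u) ({y, u} : Finset V)ᶜ
      omega)
  have hA'c : A.card ≤ ((({y, u} : Finset V)ᶜ \ B') \ H.neighborFinset y).card := by
    have h1 := Finset.le_card_sdiff (H.neighborFinset y) (({y, u} : Finset V)ᶜ \ B')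
    have h2 := Finset.le_card_sdiff B' ({y, u} : Finset V)ᶜ
    omega
  have : Nonempty V := ⟨y⟩
  obtain ⟨f, hf, hfinj⟩ := exists_map_of_card_le hA'c
  obtain ⟨g, hg, hginj⟩ := exists_map_of_card_le hB'c.ge
  have hf' : ∀ w ∈ A, f w ≠ y ∧ f w ≠ u ∧ f w ∉ B' ∧ ¬ H.Adj y (f w) := by
    intro w hw
    have := hf w hw
    simp only [Finset.mem_sdiff, Finset.mem_compl, Finset.mem_insert, Finset.mem_singleton, not_or,
      mem_neighborFinset] at this
    tauto
  have hg' : ∀ w ∈ B, g w ≠ y ∧ g w ≠ u ∧ g w ∈ B' ∧ ¬ H.Adj u (g w) := by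
    intro w hw
    have h := hg w hw
    have := hB' h
    simp only [Finset.mem_sdiff, Finset.mem_compl, Finset.mem_insert, Finset.mem_singleton, not_or,
      mem_neighborFinset] at this
    tauto
  have hBA' : ∀ w ∈ B, w ∉ A := fun w hw hw' => Finset.disjoint_left.1 hAB hw' hw
  clear hf hg hB' hA'c hXc hsum hmin hu hd hW hcard hB'c hBA
  refine ⟨fun w => if w = p then y else if w = q then u else if w ∈ A then f w else g w, ?_, ?_⟩
  · intro v w hvw
    rcases hcover v with rfl | rfl | hv | hv <;> rcases hcover w with rfl | rfl | hw | hw <;> grind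
  · have hyu' : ¬ H.Adj u y := fun h => hyu h.symm
    have hf'' : ∀ w ∈ A, ¬ H.Adj (f w) y := fun w hw h => (hf' w hw).2.2.2 h.symm
    have hg'' : ∀ w ∈ B, ¬ H.Adj (g w) u := fun w hw h => (hg' w hw).2.2.2 h.symm
    intro v w hvw
    have := hadj v w hvw
    grind

theorem deletionProperty_of_packs (hT : T.IsTree) (hcard : Fintype.card V = Fintype.card W + 2)
    (ih : ∀ (S : Finset W) (R : Finset V), S.Nonempty → (T.induce {w | w ∉ S}).IsTree →
      Fintype.card {v | v ∉ R} = Fintype.card {w | w ∉ S} + 2 →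
      ∑ v, (H.induce {v | v ∉ R}).degree v < 3 * Fintype.card {v | v ∉ R} →
      Packs (T.induce {w | w ∉ S}) (H.induce {v | v ∉ R})) : DeletionProperty T H := by
  intro S R hS hSR ⟨r, hr, hfix, hadj⟩ hsum
  have hV : Fintype.card {v | v ∉ R} = Fintype.card V - R.card := by
    rw [← Finset.card_compl]
    exact Fintype.card_of_subtype Rᶜ (by simp)
  have hW : Fintype.card {w | w ∉ S} = Fintype.card W - S.card := by
    rw [← Finset.card_compl]
    exact Fintype.card_of_subtype Sᶜ (by simp)
  have hle := S.card_le_univ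
  have hVW : Fintype.card {v | v ∉ R} = Fintype.card {w | w ∉ S} + 2 := by omega
  have hdeg := degreeSumAvoiding_induce (H := H) R
  rw [degreeSumAvoiding_empty] at hdeg
  rw [← hdeg, ← hV] at hsum
  obtain ⟨f, hinj, hf⟩ := ih S R hS ⟨hT.connected.induce_of_retraction r hr hfix hadj,
    hT.isAcyclic.induce _⟩ hVW (by convert hsum)
  have hc : (Finset.univ.image f)ᶜ.card = 2 := by
    rw [Finset.card_compl, Finset.card_image_of_injective _ hinj, Finset.card_univ]
    omega
  obtain ⟨a, b, hab, hU⟩ := Finset.card_eq_two.1 hc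
  have hfree : ∀ w, f w ≠ a ∧ f w ≠ b := by
    intro w
    have h : f w ∉ (Finset.univ.image f)ᶜ := by simp
    simpa [hU] using h
  refine ⟨fun w => if h : w ∉ S then f ⟨w, h⟩ else a, a, b, ⟨?_, ?_, ?_⟩, ?_, a.2, b.2, ?_⟩
  · intro u hu v hv huv
    have h : f ⟨u, hu⟩ = f ⟨v, hv⟩ := by simpa [hu, hv, ← Subtype.ext_iff] using huv
    exact congrArg Subtype.val (hinj h)
  · intro w hw
    simp only [hw, not_false_eq_true, dif_pos]
    exact (f ⟨w, hw⟩).2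
  · intro u hu v hv huv
    simpa [hu, hv] using hf ⟨u, hu⟩ ⟨v, hv⟩ huv
  · exact fun h => hab (Subtype.ext h)
  · intro w hw
    simpa [hw, ← Subtype.ext_iff] using hfree ⟨w, hw⟩

/-- A tree packs with any graph on two more vertices of average degree less than three. -/
theorem IsTree.packs (hT : T.IsTree) (hcard : Fintype.card V = Fintype.card W + 2)
    (hsum : ∑ v, H.degree v < 3 * Fintype.card V) : Packs T H := by
  induction hn : Fintype.card W using Nat.strong_induction_on generalizing V W with
  | _ n ih =>
  subst hn
  obtain ⟨y, hy⟩ : ∃ y, ∀ v, H.degree y ≤ H.degree v := by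
    have : Nonempty V := Fintype.card_pos_iff.1 (by omega)
    exact Finite.exists_min _
  have hd : H.degree y ≤ 2 := by
    have h1 := card_mul_degree_le hy
    by_contra hd
    have h2 := Nat.mul_le_mul_left (Fintype.card V) (show 3 ≤ H.degree y by omega)
    omega
  obtain hW | hW := subsingleton_or_nontrivial W
  · exact ⟨fun _ => y, fun u v _ => Subsingleton.elim u v,
      fun u v huv => absurd (Subsingleton.elim u v) huv.ne⟩
  obtain ⟨p, q, hpq, hdom⟩ | ⟨p, q, p', q', hp, hp', hne, hnadj⟩ :=
    hT.exists_dominating_edge_or_pendantStars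
  · obtain ⟨A, B, hAB⟩ := hT.exists_isDoubleStar hpq hdom
    exact hAB.packs hcard hsum hy hd
  have hdel : DeletionProperty T H := by
    refine deletionProperty_of_packs hT hcard fun S R hS hT' hcard' hsum' => ?_
    refine ih _ ?_ hT' hcard' hsum' rfl
    obtain ⟨w, hw⟩ := hS
    exact Fintype.card_subtype_lt (x := w) (by simpa using hw)
  by_cases hm : H.degree y ≤ (Finset.univ.filter fun w => T.Adj p w ∧ w ≠ q).card
  · exact packs_of_pendantStar_of_degree_le hdel hp hcard hsum hy hd hm
  by_cases hm' : H.degree y ≤ (Finset.univ.filter fun w => T.Adj p' w ∧ w ≠ q').card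
  · exact packs_of_pendantStar_of_degree_le hdel hp' hcard hsum hy hd hm'
  have hpos := hp.card_leaves_pos
  have hpos' := hp'.card_leaves_pos
  obtain ⟨l, hl⟩ := hp.exists_isPendantPath (by omega)
  obtain ⟨l', hl'⟩ := hp'.exists_isPendantPath (by omega)
  exact packs_of_pendantPaths_of_two_le_degree hdel hl hl' hp hne hnadj hsum
    (fun v => by have := hy v; omega) (y := y) (by omega)

end Packing

end SimpleGraph

/-- Woźniak: the Erdős–Sós conjecture holds for `k = n - 2`. -/
theorem erdos_sos_k_eq_n_sub_two {V : Type*} [Fintype V] (G : SimpleGraph V)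
    [DecidableRel G.Adj] (k : ℕ) (hk : 2 ≤ k)
    (hn : Fintype.card V = k + 2)
    (havg : (k : ℝ) - 2 < 2 * G.edgeFinset.card / Fintype.card V) :
    ∀ (W : Type) [Fintype W] (T : SimpleGraph W), T.IsTree → Fintype.card W = k →
      ∃ f : T →g G, Function.Injective f := by
  classical
  intro W _ T hT hW
  have hsum : ∑ v, Gᶜ.degree v < 3 * Fintype.card V := by
    have h1 := G.sum_degrees_eq_twice_card_edges
    have h2 : ∑ v, (G.degree v + Gᶜ.degree v) = Fintype.card V * (k + 1) := by
      have h (v) (_ : v ∈ Finset.univ) : G.degree v + Gᶜ.degree v = k + 1 := by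
        have := G.degree_lt_card_verts v
        rw [SimpleGraph.degree_compl]
        omega
      rw [Finset.sum_congr rfl h, Finset.sum_const, Finset.card_univ, smul_eq_mul]
    rw [Finset.sum_add_distrib, h1] at h2
    have hpos : (0 : ℝ) < Fintype.card V := by
      rw [hn]
      positivity
    rw [lt_div_iff₀ hpos] at havg
    have h3 : ((2 * G.edgeFinset.card + ∑ v, Gᶜ.degree v : ℕ) : ℝ) =
        ((Fintype.card V * (k + 1) : ℕ) : ℝ) := by rw [h2]
    have h4 : ((∑ v, Gᶜ.degree v : ℕ) : ℝ) < ((3 * Fintype.card V : ℕ) : ℝ) := by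
      push_cast at h3 ⊢
      linarith
    exact_mod_cast h4
  obtain ⟨f, hinj, hf⟩ := hT.packs (H := Gᶜ) (by omega) (by convert hsum)
  refine ⟨⟨f, fun {u v} huv => ?_⟩, hinj⟩
  by_contra h
  exact hf u v huv ((G.compl_adj _ _).2 ⟨fun h' => huv.ne (hinj h'), h⟩)
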